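/- For every integer m ≥ 1 and any two complex numbers λ and λ′, the resultant of the monic degree-m polynomials S_m(x) − λ·S_{m−1}(x) and S_m(x) − λ′·S_{m−1}(x) equals (−1)^{m(m−1)/2}·(λ − λ′)^m. Equivalently, if μ^{(1)}, …, μ^{(m)} are the roots of S_m(x) − λ·S_{m−1}(x) and ν^{(1)}, …, ν^{(m)} are the roots of S_m(x) − λ′·S_{m−1}(x) (with multiplicity, over ℂ), then ∏_{j=1}^m ∏_{k=1}^m (μ^{(j)} − ν^{(k)}) = (−1)^{m(m−1)/2}·(λ − λ′)^m. -/

import Mathlib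

open Polynomial

/-- The renormalized Chebyshev polynomial of the second kind, `S k x = U k (x/2)`. -/
noncomputable def chebS (k : ℤ) : Polynomial ℂ :=
  (Polynomial.Chebyshev.U ℂ k).comp (Polynomial.C 2⁻¹ * Polynomial.X)

/-- The resultant of two complex polynomials `f = aₙ∏(x-αᵢ)`, `g = bₘ∏(x-βⱼ)`:
`Res(f,g) = aₙ^m · bₘ^n · ∏ᵢⱼ (αᵢ - βⱼ)`. -/
noncomputable def res (f g : Polynomial ℂ) : ℂ :=
  f.leadingCoeff ^ g.natDegree * g.leadingCoeff ^ f.natDegree *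
    (f.roots.map fun a => (g.roots.map fun b => a - b).prod).prod

namespace Polynomial.Chebyshev

theorem natDegree_S_le_and_coeff_S_self (R : Type*) [CommRing R] (n : ℕ) :
    (S R n).natDegree ≤ n ∧ (S R n).coeff n = 1 := by
  induction n using Nat.twoStepInduction with
  | zero => simp
  | one => simp [natDegree_X_le]
  | more n ih₀ ih₁ =>
    have hS : S R ((n + 2 : ℕ) : ℤ) = X * S R ((n + 1 : ℕ) : ℤ) - S R (n : ℤ) := by
      push_cast
      exact S_add_two R n
    rw [hS]
    constructor
    · refine (natDegree_sub_le _ _).trans (max_le ?_ (by lia))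
      refine natDegree_mul_le.trans ?_
      have := natDegree_X_le (R := R)
      lia
    · rw [coeff_sub, coeff_X_mul, ih₁.2, coeff_eq_zero_of_natDegree_lt (by lia), sub_zero]

theorem natDegree_S_le (R : Type*) [CommRing R] (n : ℕ) : (S R n).natDegree ≤ n :=
  (natDegree_S_le_and_coeff_S_self R n).1

theorem coeff_S_self (R : Type*) [CommRing R] (n : ℕ) : (S R n).coeff n = 1 :=
  (natDegree_S_le_and_coeff_S_self R n).2

theorem resultant_S_succ_S (R : Type*) [CommRing R] (n : ℕ) :
    resultant (S R (n + 1 : ℕ)) (S R n) (n + 1) n = (-1) ^ ((n + 1) * n / 2) := by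
  induction n with
  | zero => simp
  | succ n ih =>
    have hS : S R ((n + 1 + 1 : ℕ) : ℤ) =
        Polynomial.C (-1) * S R (n : ℤ) + S R ((n + 1 : ℕ) : ℤ) * X := by
      have h := S_add_two R n
      push_cast
      rw [add_assoc, one_add_one_eq_two, h, map_neg, map_one]
      ring
    have hX := natDegree_X_le (R := R)
    have hexp : (n + 1 + 1) * (n + 1) / 2 = (n + 1) + (n + 1) * n / 2 := by
      rw [show (n + 1 + 1) * (n + 1) = (n + 1) * n + (n + 1) * 2 by ring,
        Nat.add_mul_div_right _ _ two_pos, add_comm]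
    rw [hS, resultant_add_mul_left _ _ _ _ _ (by lia) (natDegree_S_le R _),
      resultant_C_mul_left, resultant_add_left_deg _ _ n _ 2 (natDegree_S_le R n),
      coeff_S_self, resultant_comm, ih,
      Even.neg_one_pow (by simp : Even ((n + 1) * 2)), Even.neg_one_pow (Nat.even_mul_succ_self n), hexp]
    ring

theorem natDegree_S_sub_C_mul_S_le {R : Type*} [CommRing R] (n : ℕ) (a : R) :
    (S R (n + 1 : ℕ) - Polynomial.C a * S R n).natDegree ≤ n + 1 :=
  (natDegree_sub_le _ _).trans (max_le (natDegree_S_le R _)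
    ((natDegree_C_mul_le _ _).trans ((natDegree_S_le R n).trans n.le_succ)))

theorem coeff_S_sub_C_mul_S {R : Type*} [CommRing R] (n : ℕ) (a : R) :
    (S R (n + 1 : ℕ) - Polynomial.C a * S R n).coeff (n + 1) = 1 := by
  rw [coeff_sub, coeff_C_mul, coeff_S_self,
    coeff_eq_zero_of_natDegree_lt (Nat.lt_succ_of_le (natDegree_S_le R n)), mul_zero, sub_zero]

theorem resultant_S_sub_C_mul_S {R : Type*} [CommRing R] (n : ℕ) (a b : R) :
    resultant (S R (n + 1 : ℕ) - Polynomial.C a * S R n) (S R (n + 1 : ℕ) - Polynomial.C b * S R n) (n + 1) (n + 1) =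
      (-1) ^ ((n + 1) * n / 2) * (a - b) ^ (n + 1) := by
  have hg : S R (n + 1 : ℕ) - Polynomial.C b * S R n =
      Polynomial.C (a - b) * S R n + (S R (n + 1 : ℕ) - Polynomial.C a * S R n) * 1 := by
    rw [map_sub]
    ring
  have hf : S R (n + 1 : ℕ) - Polynomial.C a * S R n = S R (n + 1 : ℕ) + S R n * Polynomial.C (-a) := by
    rw [map_neg]
    ring
  rw [hg, resultant_add_mul_right _ _ _ _ _ (by simp) (natDegree_S_sub_C_mul_S_le n a),
    resultant_C_mul_right, resultant_add_right_deg _ _ _ _ 1 (natDegree_S_le R n),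
    coeff_S_sub_C_mul_S, hf,
    resultant_add_mul_left _ _ _ _ _ (by simp) (natDegree_S_le R n), resultant_S_succ_S]
  ring

end Polynomial.Chebyshev

theorem chebS_eq_S (k : ℤ) : chebS k = Chebyshev.S ℂ k := by
  rw [chebS, ← Chebyshev.S_comp_two_mul_X, comp_assoc]
  have h : (2 * X : ℂ[X]).comp (C 2⁻¹ * X) = X := by
    rw [← map_ofNat C 2, mul_comp, C_comp, X_comp, ← mul_assoc, ← C_mul]
    simp
  rw [h, comp_X]

theorem res_eq_prod_roots {f g : ℂ[X]} (hf : f.Monic) (hg : g.Monic) :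
    res f g = (f.roots.map fun a => (g.roots.map fun b => a - b).prod).prod := by
  simp [res, hf.leadingCoeff, hg.leadingCoeff]

theorem prod_roots_eq_resultant {f g : ℂ[X]} (hf : f.Monic) (hg : g.Monic) :
    (f.roots.map fun a => (g.roots.map fun b => a - b).prod).prod = resultant f g := by
  rw [resultant_eq_prod_eval f g _ le_rfl (IsAlgClosed.splits f), hf.leadingCoeff, one_pow,
    one_mul]
  refine congrArg Multiset.prod (Multiset.map_congr rfl fun a _ => ?_)
  rw [(IsAlgClosed.splits g).eval_eq_prod_roots_of_monic hg]

theorem resultant_chebS_combinations (m : ℕ) (hm : 1 ≤ m) (lam lam' : ℂ) :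
    res (chebS m - C lam * chebS ((m : ℤ) - 1))
        (chebS m - C lam' * chebS ((m : ℤ) - 1)) =
        (-1) ^ (m * (m - 1) / 2) * (lam - lam') ^ m ∧
    ((chebS m - C lam * chebS ((m : ℤ) - 1)).roots.map fun mu =>
          ((chebS m - C lam' * chebS ((m : ℤ) - 1)).roots.map fun nu =>
            mu - nu).prod).prod =
        (-1) ^ (m * (m - 1) / 2) * (lam - lam') ^ m := by
  obtain ⟨n, rfl⟩ := Nat.exists_eq_add_of_le' hm
  have hn : ((n + 1 : ℕ) : ℤ) - 1 = n := by simp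
  rw [hn, Nat.add_sub_cancel]
  simp only [chebS_eq_S]
  have hmonic (a : ℂ) : (Chebyshev.S ℂ (n + 1 : ℕ) - C a * Chebyshev.S ℂ n).Monic :=
    monic_of_natDegree_le_of_coeff_eq_one _ (Chebyshev.natDegree_S_sub_C_mul_S_le n a)
      (Chebyshev.coeff_S_sub_C_mul_S n a)
  have hdeg (a : ℂ) : (Chebyshev.S ℂ (n + 1 : ℕ) - C a * Chebyshev.S ℂ n).natDegree = n + 1 :=
    natDegree_eq_of_le_of_coeff_ne_zero (Chebyshev.natDegree_S_sub_C_mul_S_le n a)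
      ((Chebyshev.coeff_S_sub_C_mul_S n a).trans_ne one_ne_zero)
  rw [res_eq_prod_roots (hmonic _) (hmonic _), and_self,
    prod_roots_eq_resultant (hmonic _) (hmonic _), hdeg, hdeg]
  exact Chebyshev.resultant_S_sub_C_mul_S n lam lam'
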